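/- arXiv:1410.0992 — 3 statements merged into one kernel-verified Lean document; each statement's English description precedes it below -/
import Mathlib

section
/- Let 0<β<1/2. There exists a constant C>0, independent of t, such that for every t ∈ ℝ and every integer n ≥ 1, the integral ∫_ℝ (t−u)₊^{β−1} ξ_n(u) du converges absolutely and |∫_ℝ (t−u)₊^{β−1} ξ_n(u) du| ≤ C n^{2/3 − β/2}. -/
open MeasureTheory Set

/-- The `n`-th physicists' Hermite polynomial, as a function on ℝ, defined by the Rodrigues
formula `H_n(x) = (-1)^n e^{x²} (d/dx)^n e^{-x²}`. -/
noncomputable def physHermite (n : ℕ) (x : ℝ) : ℝ :=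
  (-1 : ℝ) ^ n * Real.exp (x ^ 2) * iteratedDeriv n (fun t : ℝ => Real.exp (-t ^ 2)) x

/-- The `n`-th Hermite function `ξ_n(x) = (2^n n! √π)^{-1/2} H_n(x) e^{-x²/2}`. -/
noncomputable def hermiteFun (n : ℕ) (x : ℝ) : ℝ :=
  ((2 : ℝ) ^ n * (n.factorial : ℝ) * Real.sqrt Real.pi) ^ (-(1 / 2) : ℝ) *
    physHermite n x * Real.exp (-x ^ 2 / 2)

/-- The `n`-th physicists' Hermite polynomial as an element of `ℝ[X]`. -/
noncomputable def physHermitePoly : ℕ → Polynomial ℝ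
  | 0 => 1
  | n + 1 => 2 * Polynomial.X * physHermitePoly n - Polynomial.derivative (physHermitePoly n)

theorem derivative_physHermitePoly_succ (n : ℕ) :
    Polynomial.derivative (physHermitePoly (n + 1)) =
      Polynomial.C (2 * ((n : ℝ) + 1)) * physHermitePoly n := by
  induction n with
  | zero => simp [physHermitePoly, Polynomial.C_ofNat]
  | succ n ih =>
    rw [physHermitePoly, Polynomial.derivative_sub, Polynomial.derivative_mul, ih,
      Polynomial.derivative_C_mul, physHermitePoly]
    simp only [Polynomial.derivative_mul, Polynomial.derivative_ofNat, Polynomial.derivative_X,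
      map_mul, map_add, Nat.cast_add, Nat.cast_one, Polynomial.C_1, Polynomial.C_ofNat]
    ring

theorem hasDerivAt_eval_mul_exp_neg_mul_sq (p : Polynomial ℝ) (b x : ℝ) :
    HasDerivAt (fun y => p.eval y * Real.exp (-b * y ^ 2))
      ((Polynomial.derivative p).eval x * Real.exp (-b * x ^ 2) -
        2 * b * x * (p.eval x * Real.exp (-b * x ^ 2))) x := by
  refine ((p.hasDerivAt x).mul (((hasDerivAt_pow 2 x).const_mul (-b)).exp)).congr_deriv ?_
  push_cast
  ring

theorem iteratedDeriv_exp_neg_sq (n : ℕ) :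
    iteratedDeriv n (fun t : ℝ => Real.exp (-t ^ 2)) =
      fun x => (-1) ^ n * ((physHermitePoly n).eval x * Real.exp (-1 * x ^ 2)) := by
  induction n with
  | zero => simp [physHermitePoly]
  | succ n ih =>
    ext x
    rw [iteratedDeriv_succ, ih,
      ((hasDerivAt_eval_mul_exp_neg_mul_sq _ _ x).const_mul _).deriv, physHermitePoly]
    simp only [Polynomial.eval_sub, Polynomial.eval_mul, Polynomial.eval_X, Polynomial.eval_ofNat]
    ring

theorem physHermite_eq_eval (n : ℕ) (x : ℝ) : physHermite n x = (physHermitePoly n).eval x := by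
  have h : Real.exp (x ^ 2) * Real.exp (-1 * x ^ 2) = 1 := by rw [← Real.exp_add]; simp
  have h2 : (-1 : ℝ) ^ n * (-1) ^ n = 1 := by rw [← mul_pow]; simp
  rw [physHermite, iteratedDeriv_exp_neg_sq]
  linear_combination (Polynomial.eval x (physHermitePoly n)) *
    (Real.exp (x ^ 2) * Real.exp (-1 * x ^ 2) * h2 + h)

theorem integrable_eval_mul_exp_neg_mul_sq (p : Polynomial ℝ) {b : ℝ} (hb : 0 < b) :
    Integrable fun x : ℝ => p.eval x * Real.exp (-b * x ^ 2) := by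
  induction p using Polynomial.induction_on' with
  | add p q hp hq => simpa only [Polynomial.eval_add, add_mul] using! hp.add hq
  | monomial n a =>
    have h := integrable_rpow_mul_exp_neg_mul_sq hb
      (show (-1 : ℝ) < n by linarith [n.cast_nonneg (α := ℝ)])
    simpa only [Polynomial.eval_monomial, Real.rpow_natCast, mul_assoc] using h.const_mul a

/-- The squared norm of the `n`-th Hermite polynomial with respect to the weight `e^{-x²}`. -/
theorem integral_sq_physHermitePoly (n : ℕ) :
    ∫ x : ℝ, (physHermitePoly n ^ 2).eval x * Real.exp (-1 * x ^ 2) =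
      2 ^ n * n.factorial * Real.sqrt Real.pi := by
  induction n with
  | zero => simpa [physHermitePoly] using integral_gaussian 1
  | succ n ih =>
    have hparts := integral_mul_deriv_eq_deriv_mul_of_integrable
      (u := fun x => (physHermitePoly (n + 1)).eval x)
      (v := fun x => (physHermitePoly n).eval x * Real.exp (-1 * x ^ 2))
      (u' := fun x => (Polynomial.derivative (physHermitePoly (n + 1))).eval x)
      (v' := fun x => -((physHermitePoly (n + 1)).eval x * Real.exp (-1 * x ^ 2)))
      (fun x _ => (physHermitePoly (n + 1)).hasDerivAt x)
      (fun x _ => by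
        refine (hasDerivAt_eval_mul_exp_neg_mul_sq (physHermitePoly n) 1 x).congr_deriv ?_
        simp only [physHermitePoly, Polynomial.eval_sub, Polynomial.eval_mul, Polynomial.eval_X,
          Polynomial.eval_ofNat]
        ring)
      ((integrable_eval_mul_exp_neg_mul_sq
        (physHermitePoly (n + 1) ^ 2) one_pos).neg.congr (.of_forall fun x => by
          simp only [Pi.neg_apply, Pi.mul_apply, Polynomial.eval_pow]; ring))
      ((integrable_eval_mul_exp_neg_mul_sq
        (Polynomial.derivative (physHermitePoly (n + 1)) * physHermitePoly n) one_pos).congr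
          (.of_forall fun x => by simp only [Pi.mul_apply, Polynomial.eval_mul]; ring))
      ((integrable_eval_mul_exp_neg_mul_sq
        (physHermitePoly (n + 1) * physHermitePoly n) one_pos).congr
          (.of_forall fun x => by simp only [Pi.mul_apply, Polynomial.eval_mul]; ring))
    have hl : ∀ x : ℝ, (physHermitePoly (n + 1) ^ 2).eval x * Real.exp (-1 * x ^ 2) =
        -((physHermitePoly (n + 1)).eval x *
          -((physHermitePoly (n + 1)).eval x * Real.exp (-1 * x ^ 2))) := fun x => by
      rw [Polynomial.eval_pow]; ring
    have hr : ∀ x : ℝ, (Polynomial.derivative (physHermitePoly (n + 1))).eval x *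
        ((physHermitePoly n).eval x * Real.exp (-1 * x ^ 2)) =
        2 * ((n : ℝ) + 1) * ((physHermitePoly n ^ 2).eval x * Real.exp (-1 * x ^ 2)) := fun x => by
      rw [derivative_physHermitePoly_succ, Polynomial.eval_mul, Polynomial.eval_C,
        Polynomial.eval_pow]
      ring
    simp_rw [hl, integral_neg, hparts, hr, integral_const_mul, ih]
    rw [Nat.factorial_succ]
    push_cast
    ring

theorem hermiteFun_eq (n : ℕ) (x : ℝ) :
    hermiteFun n x = (Real.sqrt (2 ^ n * n.factorial * Real.sqrt Real.pi))⁻¹ *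
      ((physHermitePoly n).eval x * Real.exp (-(1 / 2) * x ^ 2)) := by
  rw [hermiteFun, physHermite_eq_eval, Real.rpow_neg (by positivity), ← Real.sqrt_eq_rpow,
    mul_assoc]
  congr 3
  ring

theorem continuous_hermiteFun (n : ℕ) : Continuous (hermiteFun n) := by
  simp_rw [funext (hermiteFun_eq n)]
  fun_prop

theorem sq_exp_neg_half_sq (x : ℝ) : Real.exp (-(1 / 2) * x ^ 2) ^ 2 = Real.exp (-1 * x ^ 2) := by
  rw [← Real.exp_nat_mul]
  congr 1
  push_cast
  ring

theorem sq_hermiteFun (n : ℕ) (x : ℝ) :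
    hermiteFun n x ^ 2 = (2 ^ n * n.factorial * Real.sqrt Real.pi)⁻¹ *
      ((physHermitePoly n ^ 2).eval x * Real.exp (-1 * x ^ 2)) := by
  rw [hermiteFun_eq, mul_pow, mul_pow, sq_exp_neg_half_sq, inv_pow, Real.sq_sqrt (by positivity),
    Polynomial.eval_pow]

theorem integrable_sq_hermiteFun (n : ℕ) : Integrable fun x => hermiteFun n x ^ 2 := by
  simp_rw [sq_hermiteFun]
  exact (integrable_eval_mul_exp_neg_mul_sq _ one_pos).const_mul _

theorem integral_sq_hermiteFun (n : ℕ) : ∫ x, hermiteFun n x ^ 2 = 1 := by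
  simp_rw [sq_hermiteFun]
  rw [integral_const_mul, integral_sq_physHermitePoly]
  exact inv_mul_cancel₀ (by positivity)

/-- The ladder relation `ξ_n' = √(n/2) ξ_{n-1} - √((n+1)/2) ξ_{n+1}`. -/
theorem hasDerivAt_hermiteFun_succ (n : ℕ) (x : ℝ) :
    HasDerivAt (hermiteFun (n + 1))
      (Real.sqrt (((n : ℝ) + 1) / 2) * hermiteFun n x -
        Real.sqrt (((n : ℝ) + 2) / 2) * hermiteFun (n + 2) x) x := by
  have hstep : ∀ m : ℕ, (Real.sqrt (2 ^ m * m.factorial * Real.sqrt Real.pi))⁻¹ =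
      2 * Real.sqrt (((m : ℝ) + 1) / 2) *
        (Real.sqrt (2 ^ (m + 1) * (m + 1).factorial * Real.sqrt Real.pi))⁻¹ := by
    intro m
    have h : (2 : ℝ) ^ (m + 1) * (m + 1).factorial * Real.sqrt Real.pi =
        2 ^ 2 * (((m : ℝ) + 1) / 2) * (2 ^ m * m.factorial * Real.sqrt Real.pi) := by
      rw [Nat.factorial_succ]
      push_cast
      ring
    rw [h, Real.sqrt_mul (x := 2 ^ 2 * (((m : ℝ) + 1) / 2)) (by positivity),
      Real.sqrt_mul (x := 2 ^ 2) (by positivity), Real.sqrt_sq zero_le_two]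
    field_simp
  obtain ⟨c, hc⟩ : ∃ c : ℕ → ℝ, ∀ m : ℕ,
      (Real.sqrt (2 ^ m * m.factorial * Real.sqrt Real.pi))⁻¹ = c m := ⟨_, fun _ => rfl⟩
  simp_rw [hc] at hstep
  have h1 := hstep n
  have h2 := hstep (n + 1)
  rw [show ((n + 1 : ℕ) : ℝ) + 1 = n + 2 by push_cast; ring] at h2
  have hs1 := Real.mul_self_sqrt (show 0 ≤ ((n : ℝ) + 1) / 2 by positivity)
  have hp : (physHermitePoly (n + 2)).eval x =
      2 * x * (physHermitePoly (n + 1)).eval x -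
        2 * ((n : ℝ) + 1) * (physHermitePoly n).eval x := by
    rw [physHermitePoly, derivative_physHermitePoly_succ]
    simp
  simp_rw [funext (hermiteFun_eq (n + 1)), hermiteFun_eq, hc]
  refine ((hasDerivAt_eval_mul_exp_neg_mul_sq (physHermitePoly (n + 1)) (1 / 2) x).const_mul
    (c (n + 1))).congr_deriv ?_
  rw [derivative_physHermitePoly_succ, Polynomial.eval_mul, Polynomial.eval_C]
  set e := Real.exp (-(1 / 2) * x ^ 2)
  set p := (physHermitePoly n).eval x
  linear_combination -(Real.sqrt (((n : ℝ) + 1) / 2) * p * e) * h1 - 2 * c (n + 1) * p * e * hs1 -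
    1 / 2 * (physHermitePoly (n + 2)).eval x * e * h2 + 1 / 2 * c (n + 1) * e * hp

/-- A one-dimensional Sobolev inequality: `f(x)² ≤ a ∫ f² + a⁻¹ ∫ f'²`. -/
theorem sq_le_integral_sq_add_integral_sq {f f' : ℝ → ℝ} (hf : ∀ x, HasDerivAt f (f' x) x)
    (hi : Integrable fun x => f x ^ 2) (hi' : Integrable fun x => f' x ^ 2)
    (hm : Continuous f') {a : ℝ} (ha : 0 < a) (x : ℝ) :
    f x ^ 2 ≤ a * (∫ y, f y ^ 2) + a⁻¹ * ∫ y, f' y ^ 2 := by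
  have hd : ∀ y, HasDerivAt (fun z => f z ^ 2) (2 * f y * f' y) y := fun y => by
    simpa using! (hf y).pow 2
  have hg : Integrable fun y => a * f y ^ 2 + a⁻¹ * f' y ^ 2 :=
    (hi.const_mul a).add (hi'.const_mul _)
  have hle : ∀ y, ‖2 * f y * f' y‖ ≤ a * f y ^ 2 + a⁻¹ * f' y ^ 2 := fun y => by
    have h1 : a * a⁻¹ = 1 := mul_inv_cancel₀ ha.ne'
    have h2 : ∀ s t : ℝ, 0 ≤ a * (s - a⁻¹ * t) ^ 2 := fun s t => by positivity
    have h3 := h2 (f y) (f' y)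
    have h4 := h2 (f y) (-f' y)
    have e : ∀ s t : ℝ, a * (s - a⁻¹ * t) ^ 2 = a * s ^ 2 - 2 * s * t + a⁻¹ * t ^ 2 :=
      fun s t => by field_simp; ring
    rw [e] at h3 h4
    rw [Real.norm_eq_abs, abs_le]
    constructor <;> nlinarith
  have hfc : Continuous f := continuous_iff_continuousAt.2 fun y => (hf y).continuousAt
  have hi2 : Integrable fun y => 2 * f y * f' y :=
    hg.mono' (by fun_prop) (.of_forall hle)
  have hlim := tendsto_zero_of_hasDerivAt_of_integrableOn_Iic (a := x) (fun y _ => hd y)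
    hi2.integrableOn hi.integrableOn
  have hFTC := integral_Iic_of_hasDerivAt_of_tendsto' (a := x) (fun y _ => hd y)
    hi2.integrableOn hlim
  rw [sub_zero] at hFTC
  rw [← hFTC, ← integral_const_mul, ← integral_const_mul,
    ← integral_add (hi.const_mul a) (hi'.const_mul _)]
  calc ∫ y in Iic x, 2 * f y * f' y
      ≤ ∫ y in Iic x, (a * f y ^ 2 + a⁻¹ * f' y ^ 2) :=
        integral_mono hi2.integrableOn hg.integrableOn fun y => (le_abs_self _).trans (hle y)
    _ ≤ ∫ y, (a * f y ^ 2 + a⁻¹ * f' y ^ 2) :=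
        setIntegral_le_integral hg (.of_forall fun y => by positivity)

theorem abs_hermiteFun_le {n : ℕ} (hn : 1 ≤ n) (x : ℝ) :
    |hermiteFun n x| ≤ 2 * (n : ℝ) ^ (1 / 4 : ℝ) := by
  obtain ⟨m, rfl⟩ := Nat.exists_eq_add_of_le' hn
  set f' : ℝ → ℝ := fun y => Real.sqrt (((m : ℝ) + 1) / 2) * hermiteFun m y -
    Real.sqrt (((m : ℝ) + 2) / 2) * hermiteFun (m + 2) y
  have hc : Continuous f' := ((continuous_hermiteFun m).const_mul _).sub
    ((continuous_hermiteFun (m + 2)).const_mul _)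
  have hi1 := (integrable_sq_hermiteFun m).const_mul ((m : ℝ) + 1)
  have hi2 := (integrable_sq_hermiteFun (m + 2)).const_mul ((m : ℝ) + 2)
  have hle : ∀ y, f' y ^ 2 ≤
      ((m : ℝ) + 1) * hermiteFun m y ^ 2 + ((m : ℝ) + 2) * hermiteFun (m + 2) y ^ 2 := fun y => by
    simp only [f', sub_eq_add_neg]
    refine add_sq_le.trans_eq ?_
    rw [neg_sq, mul_pow, mul_pow, Real.sq_sqrt (by positivity), Real.sq_sqrt (by positivity)]
    ring
  have hi' : Integrable fun y => f' y ^ 2 :=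
    (hi1.add hi2).mono' (by fun_prop) (.of_forall fun y => by
      simpa only [Real.norm_eq_abs, abs_pow, sq_abs] using! hle y)
  have hint : ∫ y, f' y ^ 2 ≤ 3 * ((m : ℝ) + 1) := by
    refine (integral_mono hi' (hi1.add hi2) hle).trans ?_
    simp only [Pi.add_apply]
    rw [integral_add hi1 hi2, integral_const_mul, integral_const_mul, integral_sq_hermiteFun,
      integral_sq_hermiteFun]
    linarith [m.cast_nonneg (α := ℝ)]
  have hN : (0 : ℝ) < (m : ℝ) + 1 := by positivity
  have ha := Real.sqrt_pos.2 hN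
  have hsob := sq_le_integral_sq_add_integral_sq (hasDerivAt_hermiteFun_succ m)
    (integrable_sq_hermiteFun (m + 1)) hi' hc ha x
  rw [integral_sq_hermiteFun] at hsob
  have hmul := mul_le_mul_of_nonneg_left hint (inv_nonneg.2 ha.le)
  have hdiv : (Real.sqrt ((m : ℝ) + 1))⁻¹ * (3 * ((m : ℝ) + 1)) = 3 * Real.sqrt ((m : ℝ) + 1) := by
    rw [inv_mul_eq_iff_eq_mul₀ ha.ne']
    linear_combination -3 * Real.mul_self_sqrt hN.le
  have hroot : (((m : ℝ) + 1) ^ (1 / 4 : ℝ)) ^ 2 = Real.sqrt ((m : ℝ) + 1) := by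
    rw [Real.sqrt_eq_rpow, ← Real.rpow_mul_natCast hN.le]
    norm_num
  push_cast
  refine abs_le_of_sq_le_sq ?_ (by positivity)
  rw [mul_pow, hroot]
  linarith

/-- **Uniform bound on the fractional-kernel Hermite coefficients.**
For `0 < β < 1/2` there is a constant `C > 0`, independent of `t`, such that for every
`t ∈ ℝ` and every integer `n ≥ 1` the integral `∫ (t-u)₊^{β-1} ξ_n(u) du` converges
absolutely and is bounded in absolute value by `C n^{2/3 - β/2}`. -/
theorem hermite_coefficient_bound
    (β : ℝ) (hβ0 : 0 < β) (hβ2 : β < 1 / 2) :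
    ∃ C : ℝ, 0 < C ∧ ∀ (t : ℝ) (n : ℕ), 1 ≤ n →
      Integrable (fun u : ℝ => max (t - u) 0 ^ (β - 1) * hermiteFun n u) volume ∧
      |∫ u : ℝ, max (t - u) 0 ^ (β - 1) * hermiteFun n u|
        ≤ C * (n : ℝ) ^ ((2 : ℝ) / 3 - β / 2) := by
  set φ : ℝ → ℝ := (Ioo (0 : ℝ) 1).indicator fun s => s ^ (β - 1) with hφ
  set ψ : ℝ → ℝ := (Ici (1 : ℝ)).indicator fun s => s ^ (2 * β - 2) with hψ
  have hφi : Integrable φ := by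
    rw [hφ, integrable_indicator_iff measurableSet_Ioo,
      intervalIntegral.integrableOn_Ioo_rpow_iff one_pos]
    linarith
  have hψi : Integrable ψ := by
    rw [hψ, integrable_indicator_iff measurableSet_Ici, integrableOn_Ici_iff_integrableOn_Ioi]
    exact integrableOn_Ioi_rpow_of_lt (by linarith) one_pos
  have hφ0 : 0 ≤ ∫ s, φ s := integral_nonneg fun s =>
    indicator_nonneg (fun x hx => Real.rpow_nonneg hx.1.le _) s
  have hψ0 : 0 ≤ ∫ s, ψ s := integral_nonneg fun s =>
    indicator_nonneg (fun x hx => Real.rpow_nonneg (zero_le_one.trans hx) _) s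
  refine ⟨2 * (∫ s, φ s) + (∫ s, ψ s) + 1, by positivity, fun t n hn => ?_⟩
  have hn1 : (1 : ℝ) ≤ n := by exact_mod_cast hn
  have hξ := integrable_sq_hermiteFun n
  have hgi : Integrable fun u => 2 * (n : ℝ) ^ (1 / 4 : ℝ) * φ (t - u) +
      (ψ (t - u) + hermiteFun n u ^ 2) :=
    ((hφi.comp_sub_left t).const_mul _).add ((hψi.comp_sub_left t).add hξ)
  have hle : ∀ u, ‖max (t - u) 0 ^ (β - 1) * hermiteFun n u‖ ≤
      2 * (n : ℝ) ^ (1 / 4 : ℝ) * φ (t - u) + (ψ (t - u) + hermiteFun n u ^ 2) := by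
    intro u
    have hsup := abs_hermiteFun_le hn u
    rw [norm_mul, Real.norm_eq_abs, Real.norm_eq_abs,
      abs_of_nonneg (Real.rpow_nonneg (le_max_right _ _) _)]
    have hsq := sq_nonneg (hermiteFun n u)
    rcases le_or_gt (t - u) 0 with h0 | h0
    · have h1 : φ (t - u) = 0 := indicator_of_notMem (fun h => h0.not_gt h.1) _
      have h2 : ψ (t - u) = 0 :=
        indicator_of_notMem (fun h : (1 : ℝ) ≤ t - u => by linarith) _
      rw [h1, h2, max_eq_right h0, Real.zero_rpow (by linarith)]
      simpa using hsq
    rw [max_eq_left h0.le]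
    rcases lt_or_ge (t - u) 1 with h1 | h1
    · have h2 : φ (t - u) = (t - u) ^ (β - 1) := indicator_of_mem (show t - u ∈ Ioo (0 : ℝ) 1 from ⟨h0, h1⟩) _
      have h3 : ψ (t - u) = 0 := indicator_of_notMem (fun h => h1.not_ge h) _
      rw [h2, h3]
      have := mul_le_mul_of_nonneg_left hsup (Real.rpow_nonneg h0.le (β - 1))
      linarith
    · have h2 : φ (t - u) = 0 := indicator_of_notMem (fun h => h.2.not_ge h1) _
      have h3 : ψ (t - u) = ((t - u) ^ (β - 1)) ^ 2 := by
        rw [hψ, indicator_of_mem (show t - u ∈ Ici (1 : ℝ) from h1), ← Real.rpow_mul_natCast h0.le]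
        congr 1
        push_cast
        ring
      rw [h2, h3, ← sq_abs (hermiteFun n u)]
      nlinarith [sq_nonneg ((t - u) ^ (β - 1) - |hermiteFun n u|),
        sq_nonneg ((t - u) ^ (β - 1)), sq_nonneg |hermiteFun n u|]
  have hmeas : AEStronglyMeasurable (fun u : ℝ => max (t - u) 0 ^ (β - 1) * hermiteFun n u) := by
    have := (continuous_hermiteFun n).measurable
    exact Measurable.aestronglyMeasurable (by fun_prop)
  refine ⟨hgi.mono' hmeas (.of_forall hle), ?_⟩
  have hbound := norm_integral_le_of_norm_le hgi (.of_forall hle)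
  have hψξ : Integrable fun u => ψ (t - u) + hermiteFun n u ^ 2 := (hψi.comp_sub_left t).add hξ
  rw [integral_add ((hφi.comp_sub_left t).const_mul _) hψξ,
    integral_add (hψi.comp_sub_left t) hξ, integral_const_mul,
    integral_sub_left_eq_self φ volume t, integral_sub_left_eq_self ψ volume t,
    integral_sq_hermiteFun, Real.norm_eq_abs] at hbound
  have hq : (n : ℝ) ^ (1 / 4 : ℝ) ≤ (n : ℝ) ^ ((2 : ℝ) / 3 - β / 2) :=
    Real.rpow_le_rpow_of_exponent_le hn1 (by linarith)
  have hq1 : 1 ≤ (n : ℝ) ^ ((2 : ℝ) / 3 - β / 2) := Real.one_le_rpow hn1 (by linarith)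
  nlinarith [mul_le_mul_of_nonneg_right hq hφ0, mul_le_mul_of_nonneg_right hq1 hψ0]
end

section
/- Let 0<β<1/2 and δ>0. Then there exists a constant C>0 such that for every x ∈ ℝ and all r,s>0, ∫_ℝ ∫_ℝ exp(−(x−y)²/(δr)) · exp(−(x−z)²/(δs)) · |y−z|^{2β−1} dy dz ≤ C (rs)^{(1/2)(β+1/2)}. -/
open MeasureTheory Set

/-- The Gaussian integral `∫ exp(-(x-y)²/c) dy = √(πc)`, in `ℝ≥0∞`. -/
theorem lintegral_exp_neg_sub_sq_div {c : ℝ} (hc : 0 < c) (x : ℝ) :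
    ∫⁻ y : ℝ, ENNReal.ofReal (Real.exp (-(x - y) ^ 2 / c)) =
      ENNReal.ofReal (√(Real.pi * c)) := by
  rw [lintegral_sub_left_eq_self
    (fun u : ℝ => ENNReal.ofReal (Real.exp (-u ^ 2 / c))) x]
  have hform : ∀ u : ℝ, Real.exp (-u ^ 2 / c) = Real.exp (-c⁻¹ * u ^ 2) := fun u => by
    congr 1; field_simp
  simp_rw [hform]
  rw [← ofReal_integral_eq_lintegral_ofReal (integrable_exp_neg_mul_sq (inv_pos.2 hc))
    (Filter.Eventually.of_forall fun u => (Real.exp_pos _).le), integral_gaussian, div_inv_eq_mul]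

/-- The integral of `u ^ p` over `(0, a]` for `p > -1`, in `ℝ≥0∞`. -/
theorem setLIntegral_Ioc_rpow {p a : ℝ} (hp : -1 < p) (ha : 0 ≤ a) :
    ∫⁻ u in Ioc 0 a, ENNReal.ofReal (u ^ p) = ENNReal.ofReal (a ^ (p + 1) / (p + 1)) := by
  have hint : IntegrableOn (fun u : ℝ => u ^ p) (Ioc 0 a) :=
    (intervalIntegrable_iff_integrableOn_Ioc_of_le ha).1
      (intervalIntegral.intervalIntegrable_rpow' hp)
  rw [← ofReal_integral_eq_lintegral_ofReal hint
    ((ae_restrict_mem measurableSet_Ioc).mono fun u hu => Real.rpow_nonneg hu.1.le _),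
    ← intervalIntegral.integral_of_le ha, integral_rpow (Or.inl hp),
    Real.zero_rpow (by linarith), sub_zero]

/-- A Gaussian of variance of order `s`, integrated against the Riesz kernel with any centre, is
`O(s ^ β)`. -/
theorem lintegral_gaussian_mul_riesz_le {β δ s : ℝ} (hβ0 : 0 < β) (hβ2 : β < 1 / 2)
    (hδ : 0 < δ) (hs : 0 < s) (x y : ℝ) :
    ∫⁻ z : ℝ, ENNReal.ofReal (Real.exp (-(x - z) ^ 2 / (δ * s)) * |y - z| ^ (2 * β - 1))
      ≤ ENNReal.ofReal ((1 / β + √(Real.pi * δ)) * s ^ β) := by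
  have hsq : 0 < √s := Real.sqrt_pos.2 hs
  set g : ℝ → ENNReal :=
    (Ioc 0 (√s)).indicator fun u => ENNReal.ofReal (u ^ (2 * β - 1)) with hg
  have hgm : Measurable g := by
    refine Measurable.indicator ?_ measurableSet_Ioc
    fun_prop
  have hgi : ∫⁻ u, g u = ENNReal.ofReal (s ^ β / (2 * β)) := by
    rw [hg, lintegral_indicator measurableSet_Ioc,
      setLIntegral_Ioc_rpow (by linarith) hsq.le, Real.sqrt_eq_rpow, ← Real.rpow_mul hs.le]
    congr 3 <;> ring
  have hpt : ∀ z : ℝ,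
      ENNReal.ofReal (Real.exp (-(x - z) ^ 2 / (δ * s)) * |y - z| ^ (2 * β - 1)) ≤
        g (y - z) + g (-(y - z)) + ENNReal.ofReal (s ^ (β - 1 / 2)) *
          ENNReal.ofReal (Real.exp (-(x - z) ^ 2 / (δ * s))) := by
    intro z
    have he1 : Real.exp (-(x - z) ^ 2 / (δ * s)) ≤ 1 :=
      Real.exp_le_one_iff.2 (div_nonpos_of_nonpos_of_nonneg (by nlinarith [sq_nonneg (x - z)])
        (by positivity))
    have hle : Real.exp (-(x - z) ^ 2 / (δ * s)) * |y - z| ^ (2 * β - 1) ≤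
        |y - z| ^ (2 * β - 1) :=
      mul_le_of_le_one_left (by positivity) he1
    rcases le_or_gt |y - z| (√s) with hnear | hfar
    · refine le_add_right ((ENNReal.ofReal_le_ofReal hle).trans ?_)
      rcases lt_trichotomy (y - z) 0 with h | h | h
      · rw [abs_of_neg h] at hnear ⊢
        refine le_add_left ?_
        rw [hg, indicator_of_mem (show -(y - z) ∈ Ioc 0 (√s) from ⟨by linarith, hnear⟩)]
      · rw [h, abs_zero, Real.zero_rpow (by linarith)]
        simp
      · rw [abs_of_pos h] at hnear ⊢
        refine le_add_right ?_
        rw [hg, indicator_of_mem (show y - z ∈ Ioc 0 (√s) from ⟨h, hnear⟩)]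
    · refine le_add_left ?_
      rw [← ENNReal.ofReal_mul (by positivity), mul_comm]
      refine ENNReal.ofReal_le_ofReal (mul_le_mul_of_nonneg_right ?_ (Real.exp_pos _).le)
      calc |y - z| ^ (2 * β - 1) ≤ (√s) ^ (2 * β - 1) :=
            Real.rpow_le_rpow_of_nonpos hsq hfar.le (by linarith)
        _ = s ^ (β - 1 / 2) := by
            rw [Real.sqrt_eq_rpow, ← Real.rpow_mul hs.le]
            congr 1; ring
  refine (lintegral_mono hpt).trans (le_of_eq ?_)
  rw [lintegral_add_left (by fun_prop), lintegral_add_left (by fun_prop),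
    lintegral_sub_left_eq_self g y, lintegral_sub_left_eq_self (fun u => g (-u)) y,
    lintegral_neg_eq_self g, lintegral_const_mul _ (by fun_prop),
    lintegral_exp_neg_sub_sq_div (by positivity), hgi,
    ← ENNReal.ofReal_mul (by positivity), ← ENNReal.ofReal_add (by positivity) (by positivity),
    ← ENNReal.ofReal_add (by positivity) (by positivity)]
  congr 1
  have hsβ : s ^ (β - 1 / 2) * √s = s ^ β := by
    rw [Real.sqrt_eq_rpow, ← Real.rpow_add hs]
    congr 1; ring
  rw [← mul_assoc, Real.sqrt_mul (by positivity), ← hsβ]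
  field_simp
  ring

/-- The double integral bounded by integrating the `z`-variable against the Riesz kernel first. -/
theorem lintegral_lintegral_gaussian_mul_riesz_le {β δ r s : ℝ} (hβ0 : 0 < β)
    (hβ2 : β < 1 / 2) (hδ : 0 < δ) (hr : 0 < r) (hs : 0 < s) (hrs : r ≤ s) (x : ℝ) :
    ∫⁻ y : ℝ, ∫⁻ z : ℝ,
        ENNReal.ofReal
          (Real.exp (-(x - y) ^ 2 / (δ * r)) * Real.exp (-(x - z) ^ 2 / (δ * s)) *
            |y - z| ^ (2 * β - 1))
      ≤ ENNReal.ofReal ((1 / β + √(Real.pi * δ)) * √(Real.pi * δ) *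
          (r * s) ^ ((1 / 2) * (β + 1 / 2))) := by
  have hinner : ∀ y : ℝ, ∫⁻ z : ℝ,
      ENNReal.ofReal
        (Real.exp (-(x - y) ^ 2 / (δ * r)) * Real.exp (-(x - z) ^ 2 / (δ * s)) *
          |y - z| ^ (2 * β - 1)) ≤
      ENNReal.ofReal (Real.exp (-(x - y) ^ 2 / (δ * r))) *
        ENNReal.ofReal ((1 / β + √(Real.pi * δ)) * s ^ β) := by
    intro y
    simp_rw [mul_assoc (Real.exp (-(x - y) ^ 2 / (δ * r))),
      ENNReal.ofReal_mul (Real.exp_pos (-(x - y) ^ 2 / (δ * r))).le]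
    rw [lintegral_const_mul _ (by fun_prop)]
    gcongr
    exact lintegral_gaussian_mul_riesz_le hβ0 hβ2 hδ hs x y
  have hpow : √r * s ^ β ≤ (r * s) ^ ((1 / 2) * (β + 1 / 2)) := by
    calc √r * s ^ β
        = r ^ ((1 / 2) * (β + 1 / 2)) * r ^ (1 / 4 - β / 2) * s ^ β := by
          rw [Real.sqrt_eq_rpow, ← Real.rpow_add hr]
          congr 2; ring
      _ ≤ r ^ ((1 / 2) * (β + 1 / 2)) * s ^ (1 / 4 - β / 2) * s ^ β := by
          have := Real.rpow_le_rpow hr.le hrs (show 0 ≤ 1 / 4 - β / 2 by linarith)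
          gcongr
      _ = (r * s) ^ ((1 / 2) * (β + 1 / 2)) := by
          rw [mul_assoc, ← Real.rpow_add hs, Real.mul_rpow hr.le hs.le]
          congr 2; ring
  refine (lintegral_mono hinner).trans ?_
  rw [lintegral_mul_const _ (by fun_prop), lintegral_exp_neg_sub_sq_div (by positivity),
    ← ENNReal.ofReal_mul (by positivity)]
  refine ENNReal.ofReal_le_ofReal ?_
  calc √(Real.pi * (δ * r)) * ((1 / β + √(Real.pi * δ)) * s ^ β)
      = (1 / β + √(Real.pi * δ)) * √(Real.pi * δ) * (√r * s ^ β) := by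
        rw [← mul_assoc Real.pi, Real.sqrt_mul (by positivity)]
        ring
    _ ≤ _ := by gcongr


/-- **Gaussian–Riesz kernel estimate.** For `0 < β < 1/2` and `δ > 0` there is a constant
`C > 0` such that for every `x ∈ ℝ` and all `r, s > 0`,
`∫∫ exp(-(x-y)²/(δr)) exp(-(x-z)²/(δs)) |y-z|^{2β-1} dy dz ≤ C (rs)^{(1/2)(β+1/2)}`. -/
theorem gaussian_riesz_kernel_estimate
    (β δ : ℝ) (hβ0 : 0 < β) (hβ2 : β < 1 / 2) (hδ : 0 < δ) :
    ∃ C : ℝ, 0 < C ∧ ∀ (x r s : ℝ), 0 < r → 0 < s →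
      ∫⁻ y : ℝ, ∫⁻ z : ℝ,
          ENNReal.ofReal
            (Real.exp (-(x - y) ^ 2 / (δ * r)) * Real.exp (-(x - z) ^ 2 / (δ * s)) *
              |y - z| ^ (2 * β - 1))
        ≤ ENNReal.ofReal (C * (r * s) ^ ((1 / 2) * (β + 1 / 2))) := by
  refine ⟨(1 / β + √(Real.pi * δ)) * √(Real.pi * δ), by positivity, fun x r s hr hs => ?_⟩
  rcases le_total r s with hrs | hsr
  · exact lintegral_lintegral_gaussian_mul_riesz_le hβ0 hβ2 hδ hr hs hrs x
  · rw [lintegral_lintegral_swap (by fun_prop), mul_comm r s]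
    refine le_of_eq_of_le ?_
      (lintegral_lintegral_gaussian_mul_riesz_le hβ0 hβ2 hδ hs hr hsr x)
    refine lintegral_congr fun z => lintegral_congr fun y => ?_
    rw [abs_sub_comm y z, mul_comm (Real.exp (-(x - y) ^ 2 / (δ * r)))]
end

section
/- Let d ≥ 1, T>0, and L ≥ 0. Let f: ℝ → ℝ satisfy |f(x)−f(y)| ≤ L|x−y| for all x,y ∈ ℝ, and let w: [0,T]×ℝ^d → ℝ be measurable and bounded. Then there exists a bounded measurable function u: [0,T]×ℝ^d → ℝ such that for all t ∈ [0,T] and x ∈ ℝ^d, u(t,x) = w(t,x) + ∫₀^t ∫_{ℝ^d} f(u(s,y)) · (t−s)^{−d/2} exp(−|x−y|²/(2(t−s))) dy ds, and u is the unique bounded measurable solution of this integral equation. -/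
open MeasureTheory Set

/-- `u` is a bounded measurable solution on `[0,T] × ℝ^d` of the mild formulation of the
quasi-linear heat equation with nonlinearity `f` and inhomogeneous term `w`:
`u(t,x) = w(t,x) + ∫₀^t ∫_{ℝ^d} f(u(s,y)) (t-s)^{-d/2} exp(-|x-y|²/(2(t-s))) dy ds`. -/
def IsMildSolution (d : ℕ) (T : ℝ) (f : ℝ → ℝ)
    (w u : ℝ → EuclideanSpace ℝ (Fin d) → ℝ) : Prop :=
  Measurable (fun q : (Icc (0 : ℝ) T) × EuclideanSpace ℝ (Fin d) => u q.1 q.2) ∧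
  (∃ M : ℝ, ∀ t ∈ Icc (0 : ℝ) T, ∀ x, |u t x| ≤ M) ∧
  ∀ t ∈ Icc (0 : ℝ) T, ∀ x, u t x = w t x +
    ∫ s in Ioc (0 : ℝ) t, ∫ y : EuclideanSpace ℝ (Fin d),
      f (u s y) * ((t - s) ^ (-(d : ℝ) / 2) * Real.exp (-‖x - y‖ ^ 2 / (2 * (t - s))))

open Filter Topology

/-- The Gaussian heat kernel, without its normalising constant. -/
noncomputable def heatKernel {d : ℕ} (r : ℝ) (z : EuclideanSpace ℝ (Fin d)) : ℝ :=
  r ^ (-(d : ℝ) / 2) * Real.exp (-‖z‖ ^ 2 / (2 * r))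

/-- The spatial convolution of `f ∘ u` at time `s` with the heat kernel at time `t - s`. -/
noncomputable def heatConv {d : ℕ} (f : ℝ → ℝ) (u : ℝ → EuclideanSpace ℝ (Fin d) → ℝ)
    (t : ℝ) (x : EuclideanSpace ℝ (Fin d)) (s : ℝ) : ℝ :=
  ∫ y, f (u s y) * heatKernel (t - s) (x - y)

/-- The Picard map of the mild formulation. -/
noncomputable def picardMap {d : ℕ} (f : ℝ → ℝ) (w u : ℝ → EuclideanSpace ℝ (Fin d) → ℝ)
    (t : ℝ) (x : EuclideanSpace ℝ (Fin d)) : ℝ :=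
  w t x + ∫ s in Ioc (0 : ℝ) t, heatConv f u t x s

/-- Bounded measurable functions on `[0,T] × ℝ^d`. -/
def IsBoundedMeasurable {d : ℕ} (T : ℝ) (u : ℝ → EuclideanSpace ℝ (Fin d) → ℝ) : Prop :=
  Measurable (fun q : (Icc (0 : ℝ) T) × EuclideanSpace ℝ (Fin d) => u q.1 q.2) ∧
  ∃ M : ℝ, ∀ t ∈ Icc (0 : ℝ) T, ∀ x, |u t x| ≤ M

section Picard

variable {d : ℕ} {T L : ℝ} {f : ℝ → ℝ} {w u v : ℝ → EuclideanSpace ℝ (Fin d) → ℝ}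

theorem heatKernel_nonneg {r : ℝ} (hr : 0 ≤ r) (z : EuclideanSpace ℝ (Fin d)) :
    0 ≤ heatKernel r z := by
  unfold heatKernel; positivity

theorem integral_heatKernel {r : ℝ} (hr : 0 < r) (x : EuclideanSpace ℝ (Fin d)) :
    ∫ y, heatKernel r (x - y) = (2 * Real.pi) ^ ((d : ℝ) / 2) := by
  rw [integral_sub_left_eq_self (fun z => heatKernel r z) volume x]
  unfold heatKernel
  rw [integral_const_mul]
  have h := GaussianFourier.integral_rexp_neg_mul_sq_norm
    (V := EuclideanSpace ℝ (Fin d)) (b := 1 / (2 * r)) (by positivity)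
  have e : ∀ z : EuclideanSpace ℝ (Fin d),
      -‖z‖ ^ 2 / (2 * r) = -(1 / (2 * r)) * ‖z‖ ^ 2 := fun z => by ring
  simp_rw [e]
  rw [h, finrank_euclideanSpace_fin]
  have e2 : Real.pi / (1 / (2 * r)) = (2 * Real.pi) * r := by field_simp
  rw [e2, Real.mul_rpow (by positivity) hr.le, mul_left_comm, ← Real.rpow_add hr]
  have : -(d : ℝ) / 2 + d / 2 = 0 := by ring
  simp [this]

theorem integrable_heatKernel {r : ℝ} (hr : 0 < r) (x : EuclideanSpace ℝ (Fin d)) :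
    Integrable fun y => heatKernel r (x - y) := by
  by_contra h
  have h1 := integral_heatKernel hr x
  rw [integral_undef h] at h1
  have : 0 < (2 * Real.pi) ^ ((d : ℝ) / 2) := by positivity
  linarith

theorem measurable_of_lipschitz_bound (hf : ∀ x y : ℝ, |f x - f y| ≤ L * |x - y|) :
    Measurable f :=
  (LipschitzWith.of_dist_le' (K := L) fun x y => by
    simpa [Real.dist_eq] using hf x y).continuous.measurable

theorem IsBoundedMeasurable.measurable_slice (hu : IsBoundedMeasurable T u) {s : ℝ}
    (hs : s ∈ Icc 0 T) : Measurable (u s) :=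
  hu.1.comp (measurable_const.prodMk measurable_id :
    Measurable fun y : EuclideanSpace ℝ (Fin d) => ((⟨s, hs⟩ : Icc (0 : ℝ) T), y))

theorem IsBoundedMeasurable.comp (hu : IsBoundedMeasurable T u)
    (hf : ∀ x y : ℝ, |f x - f y| ≤ L * |x - y|) (hL : 0 ≤ L) :
    IsBoundedMeasurable T fun t x => f (u t x) := by
  obtain ⟨M, hM⟩ := hu.2
  refine ⟨(measurable_of_lipschitz_bound hf).comp hu.1, |f 0| + L * M, fun t ht x => ?_⟩
  have h1 := hf (u t x) 0
  rw [sub_zero] at h1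
  have h2 := mul_le_mul_of_nonneg_left (hM t ht x) hL
  have h3 := abs_sub_abs_le_abs_sub (f (u t x)) (f 0)
  linarith

/-- Convolving a function bounded by `A` with the heat kernel gives at most `A` times its mass. -/
theorem abs_integral_mul_heatKernel_le {g : EuclideanSpace ℝ (Fin d) → ℝ} {A r : ℝ}
    (hr : 0 < r) (x : EuclideanSpace ℝ (Fin d)) (hg : ∀ y, |g y| ≤ A) :
    |∫ y, g y * heatKernel r (x - y)| ≤ A * (2 * Real.pi) ^ ((d : ℝ) / 2) := by
  rw [← integral_heatKernel hr x, ← integral_const_mul, ← Real.norm_eq_abs]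
  refine norm_integral_le_of_norm_le ((integrable_heatKernel hr x).const_mul A)
    (ae_of_all _ fun y => ?_)
  rw [Real.norm_eq_abs, abs_mul, abs_of_nonneg (heatKernel_nonneg hr.le _)]
  exact mul_le_mul_of_nonneg_right (hg y) (heatKernel_nonneg hr.le _)

theorem integrable_mul_heatKernel {g : EuclideanSpace ℝ (Fin d) → ℝ} {A r : ℝ}
    (hr : 0 < r) (x : EuclideanSpace ℝ (Fin d)) (hgm : Measurable g) (hg : ∀ y, |g y| ≤ A) :
    Integrable fun y => g y * heatKernel r (x - y) :=
  (integrable_heatKernel hr x).bdd_mul hgm.aestronglyMeasurable (ae_of_all _ hg)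

theorem IsBoundedMeasurable.stronglyMeasurable_heatConv (hT : 0 ≤ T)
    (hu : IsBoundedMeasurable T u) (hf : ∀ x y : ℝ, |f x - f y| ≤ L * |x - y|) :
    StronglyMeasurable fun p : (ℝ × EuclideanSpace ℝ (Fin d)) × ℝ =>
      heatConv f (fun s y => u (projIcc 0 T hT s) y) p.1.1 p.1.2 p.2 := by
  unfold heatConv
  refine StronglyMeasurable.integral_prod_right'
    (f := fun q : ((ℝ × EuclideanSpace ℝ (Fin d)) × ℝ) × EuclideanSpace ℝ (Fin d) =>
      f (u (projIcc 0 T hT q.1.2) q.2) * heatKernel (q.1.1.1 - q.1.2) (q.1.1.2 - q.2)) ?_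
  refine Measurable.stronglyMeasurable (Measurable.mul ?_ ?_)
  · refine (measurable_of_lipschitz_bound hf).comp (hu.1.comp
      (Measurable.prodMk ((continuous_projIcc (h := hT)).measurable.comp ?_) measurable_snd))
    fun_prop
  · unfold heatKernel
    fun_prop

theorem heatConv_projIcc (hT : 0 ≤ T) {s : ℝ} (hs : s ∈ Icc 0 T) (t : ℝ)
    (x : EuclideanSpace ℝ (Fin d)) :
    heatConv f (fun s y => u (projIcc 0 T hT s) y) t x s = heatConv f u t x s := by
  simp only [heatConv, projIcc_of_mem hT hs]

theorem IsBoundedMeasurable.measurable_picardMap (hT : 0 ≤ T)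
    (hw : IsBoundedMeasurable T w) (hu : IsBoundedMeasurable T u)
    (hf : ∀ x y : ℝ, |f x - f y| ≤ L * |x - y|) :
    Measurable (fun q : (Icc (0 : ℝ) T) × EuclideanSpace ℝ (Fin d) =>
      picardMap f w u q.1 q.2) := by
  unfold picardMap
  refine hw.1.add ?_
  have key : Measurable fun q : ℝ × EuclideanSpace ℝ (Fin d) =>
      ∫ s, {p : (ℝ × EuclideanSpace ℝ (Fin d)) × ℝ | 0 < p.2 ∧ p.2 ≤ p.1.1}.indicator
        (fun p => heatConv f (fun s y => u (projIcc 0 T hT s) y) p.1.1 p.1.2 p.2) (q, s) := by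
    refine (StronglyMeasurable.integral_prod_right' ?_).measurable
    refine (hu.stronglyMeasurable_heatConv hT hf).indicator ?_
    exact (measurableSet_lt measurable_const measurable_snd).inter
      (measurableSet_le measurable_snd (measurable_fst.comp measurable_fst))
  have hm : Measurable fun q : (Icc (0 : ℝ) T) × EuclideanSpace ℝ (Fin d) =>
      ((q.1 : ℝ), q.2) := by fun_prop
  convert key.comp hm using 2 with q
  simp only [Function.comp]
  rw [← integral_indicator measurableSet_Ioc]
  refine integral_congr_ae (ae_of_all _ fun s => ?_)
  by_cases hs : s ∈ Ioc (0 : ℝ) q.1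
  · have hs' : s ∈ Icc 0 T := ⟨hs.1.le, hs.2.trans q.1.2.2⟩
    simp only [indicator_of_mem hs]
    rw [indicator_of_mem (by exact hs)]
    exact (heatConv_projIcc hT hs' _ _).symm
  · simp only [indicator_of_notMem hs]
    rw [indicator_of_notMem (by exact hs)]

theorem IsBoundedMeasurable.exists_abs_heatConv_le (hL : 0 ≤ L)
    (hu : IsBoundedMeasurable T u) (hf : ∀ x y : ℝ, |f x - f y| ≤ L * |x - y|) :
    ∃ A : ℝ, ∀ t ∈ Icc 0 T, ∀ x, ∀ s ∈ Ioo 0 t, |heatConv f u t x s| ≤ A := by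
  obtain ⟨M, hM⟩ := (hu.comp hf hL).2
  exact ⟨_, fun t ht x s hs => abs_integral_mul_heatKernel_le (sub_pos.2 hs.2) x
    (hM s ⟨hs.1.le, hs.2.le.trans ht.2⟩)⟩

theorem IsBoundedMeasurable.integrableOn_heatConv (hT : 0 ≤ T) (hL : 0 ≤ L)
    (hu : IsBoundedMeasurable T u) (hf : ∀ x y : ℝ, |f x - f y| ≤ L * |x - y|)
    {t : ℝ} (ht : t ∈ Icc 0 T) (x : EuclideanSpace ℝ (Fin d)) :
    IntegrableOn (heatConv f u t x) (Ioo 0 t) := by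
  obtain ⟨A, hA⟩ := hu.exists_abs_heatConv_le hL hf
  refine IntegrableOn.of_bound (C := A) (by simp) ?_
    ((ae_restrict_iff' measurableSet_Ioo).2 (ae_of_all _ fun s hs => hA t ht x s hs))
  have h := ((hu.stronglyMeasurable_heatConv hT hf).comp_measurable
    (measurable_prodMk_left (x := (t, x)))).aestronglyMeasurable (μ := volume.restrict (Ioo 0 t))
  refine h.congr ((ae_restrict_iff' measurableSet_Ioo).2 (ae_of_all _ fun s hs => ?_))
  exact heatConv_projIcc hT ⟨hs.1.le, hs.2.le.trans ht.2⟩ t x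

theorem IsBoundedMeasurable.picardMap (hT : 0 ≤ T) (hL : 0 ≤ L)
    (hw : IsBoundedMeasurable T w) (hu : IsBoundedMeasurable T u)
    (hf : ∀ x y : ℝ, |f x - f y| ≤ L * |x - y|) :
    IsBoundedMeasurable T (picardMap f w u) := by
  refine ⟨hw.measurable_picardMap hT hu hf, ?_⟩
  obtain ⟨A, hA⟩ := hu.exists_abs_heatConv_le hL hf
  obtain ⟨B, hB⟩ := hw.2
  refine ⟨B + |A| * T, fun t ht x => (abs_add_le _ _).trans (add_le_add (hB t ht x) ?_)⟩
  rw [integral_Ioc_eq_integral_Ioo, ← Real.norm_eq_abs]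
  refine (norm_setIntegral_le_of_norm_le_const (C := |A|) (by simp)
    fun s hs => (hA t ht x s hs).trans (le_abs_self A)).trans ?_
  simp only [Measure.real, Real.volume_Ioo, sub_zero, ENNReal.toReal_ofReal ht.1]
  exact mul_le_mul_of_nonneg_left ht.2 (abs_nonneg A)

/-- The growth rate for which the Picard map halves distances in the weighted sup norm. -/
noncomputable def picardRate (d : ℕ) (L : ℝ) : ℝ := 2 * (L * (2 * Real.pi) ^ ((d : ℝ) / 2)) + 1

theorem picardRate_pos (hL : 0 ≤ L) : 0 < picardRate d L := by
  unfold picardRate; positivity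

theorem abs_picardMap_sub_le (hT : 0 ≤ T) (hL : 0 ≤ L)
    (hu : IsBoundedMeasurable T u) (hv : IsBoundedMeasurable T v)
    (hf : ∀ x y : ℝ, |f x - f y| ≤ L * |x - y|) {D : ℝ} (hD : 0 ≤ D)
    (huv : ∀ t ∈ Icc 0 T, ∀ x, |u t x - v t x| ≤ D * Real.exp (picardRate d L * t))
    {t : ℝ} (ht : t ∈ Icc 0 T) (x : EuclideanSpace ℝ (Fin d)) :
    |picardMap f w u t x - picardMap f w v t x| ≤ D / 2 * Real.exp (picardRate d L * t) := by
  set c := picardRate d L with hc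
  have hc0 : 0 < c := picardRate_pos hL
  set C : ℝ := (2 * Real.pi) ^ ((d : ℝ) / 2) with hC
  have hC0 : 0 ≤ C := by positivity
  have hconv : ∀ s ∈ Ioo 0 t,
      |heatConv f u t x s - heatConv f v t x s| ≤ L * D * C * Real.exp (c * s) := by
    intro s hs
    have hr := sub_pos.2 hs.2
    have hs' : s ∈ Icc 0 T := ⟨hs.1.le, hs.2.le.trans ht.2⟩
    obtain ⟨M, hM⟩ := (hu.comp hf hL).2
    obtain ⟨N, hN⟩ := (hv.comp hf hL).2
    unfold heatConv
    rw [← integral_sub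
      (integrable_mul_heatKernel hr x ((hu.comp hf hL).measurable_slice hs') (hM s hs'))
      (integrable_mul_heatKernel hr x ((hv.comp hf hL).measurable_slice hs') (hN s hs'))]
    simp_rw [← sub_mul]
    refine (abs_integral_mul_heatKernel_le (A := L * (D * Real.exp (c * s))) hr x
      fun y => (hf _ _).trans (mul_le_mul_of_nonneg_left (huv s hs' y) hL)).trans_eq ?_
    ring
  have hint : ∫ s in Ioc 0 t, L * D * C * Real.exp (c * s)
      = L * D * C * ((Real.exp (c * t) - 1) / c) := by
    rw [← intervalIntegral.integral_of_le ht.1, intervalIntegral.integral_const_mul,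
      intervalIntegral.integral_comp_mul_left _ hc0.ne', integral_exp]
    simp [div_eq_inv_mul]
  unfold picardMap
  rw [add_sub_add_left_eq_sub, integral_Ioc_eq_integral_Ioo, integral_Ioc_eq_integral_Ioo,
    ← integral_sub (hu.integrableOn_heatConv hT hL hf ht x)
      (hv.integrableOn_heatConv hT hL hf ht x), ← Real.norm_eq_abs]
  have hexp : IntegrableOn (fun s => L * D * C * Real.exp (c * s)) (Ioo 0 t) :=
    ((by fun_prop : Continuous fun s => L * D * C * Real.exp (c * s)).integrableOn_Icc).mono_set
      Ioo_subset_Icc_self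
  refine (norm_integral_le_of_norm_le hexp
    ((ae_restrict_iff' measurableSet_Ioo).2 (ae_of_all _ hconv))).trans ?_
  rw [← integral_Ioc_eq_integral_Ioo, hint]
  have h1 : L * C ≤ c / 2 := by rw [hc, picardRate]; linarith
  calc L * D * C * ((Real.exp (c * t) - 1) / c)
      = (L * C) * (D * ((Real.exp (c * t) - 1) / c)) := by ring
    _ ≤ c / 2 * (D * ((Real.exp (c * t) - 1) / c)) := by
        refine mul_le_mul_of_nonneg_right h1 (mul_nonneg hD (div_nonneg ?_ hc0.le))
        exact sub_nonneg.2 (Real.one_le_exp (mul_nonneg hc0.le ht.1))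
    _ = D / 2 * (Real.exp (c * t) - 1) := by field_simp
    _ ≤ D / 2 * Real.exp (c * t) := by gcongr; linarith

theorem isMildSolution_iff :
    IsMildSolution d T f w u ↔
      IsBoundedMeasurable T u ∧ ∀ t ∈ Icc 0 T, ∀ x, u t x = picardMap f w u t x :=
  and_assoc.symm

theorem IsBoundedMeasurable.exists_abs_sub_le (hL : 0 ≤ L) (hu : IsBoundedMeasurable T u)
    (hv : IsBoundedMeasurable T v) :
    ∃ D : ℝ, 0 ≤ D ∧
      ∀ t ∈ Icc 0 T, ∀ x, |u t x - v t x| ≤ D * Real.exp (picardRate d L * t) := by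
  obtain ⟨M, hM⟩ := hu.2
  obtain ⟨N, hN⟩ := hv.2
  refine ⟨|M| + |N|, by positivity, fun t ht x => ?_⟩
  have h1 := abs_sub (u t x) (v t x)
  have h2 : 1 ≤ Real.exp (picardRate d L * t) :=
    Real.one_le_exp (mul_nonneg (picardRate_pos hL).le ht.1)
  have h3 := (hM t ht x).trans (le_abs_self M)
  have h4 := (hN t ht x).trans (le_abs_self N)
  have h5 : |u t x - v t x| ≤ |M| + |N| := by linarith
  exact h5.trans (le_mul_of_one_le_right (by positivity) h2)

theorem tendsto_div_two_pow_mul (D b : ℝ) :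
    Tendsto (fun n : ℕ => D / 2 ^ n * b) atTop (𝓝 0) := by
  have h := ((tendsto_pow_atTop_nhds_zero_of_lt_one (r := (1 / 2 : ℝ))
    (by norm_num) (by norm_num)).const_mul D).mul_const b
  simpa [div_eq_mul_inv] using h

theorem IsMildSolution.eq (hT : 0 ≤ T) (hL : 0 ≤ L)
    (hf : ∀ x y : ℝ, |f x - f y| ≤ L * |x - y|) (hu : IsMildSolution d T f w u)
    (hv : IsMildSolution d T f w v) {t : ℝ} (ht : t ∈ Icc 0 T)
    (x : EuclideanSpace ℝ (Fin d)) : u t x = v t x := by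
  rw [isMildSolution_iff] at hu hv
  obtain ⟨D, hD, hb⟩ := hu.1.exists_abs_sub_le hL hv.1
  have key : ∀ n : ℕ, ∀ t ∈ Icc 0 T, ∀ x,
      |u t x - v t x| ≤ D / 2 ^ n * Real.exp (picardRate d L * t) := by
    intro n
    induction n with
    | zero => simpa using hb
    | succ n ih =>
      intro t ht x
      rw [hu.2 t ht x, hv.2 t ht x, pow_succ, ← div_div]
      exact abs_picardMap_sub_le hT hL hu.1 hv.1 hf (by positivity) ih ht x
  have h0 := ge_of_tendsto' (tendsto_div_two_pow_mul D (Real.exp (picardRate d L * t)))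
    fun n => key n t ht x
  exact sub_eq_zero.1 (abs_nonpos_iff.1 h0)

theorem exists_isMildSolution (hT : 0 ≤ T) (hL : 0 ≤ L)
    (hf : ∀ x y : ℝ, |f x - f y| ≤ L * |x - y|) (hw : IsBoundedMeasurable T w) :
    ∃ u, IsMildSolution d T f w u := by
  set c := picardRate d L
  let g : ℕ → ℝ → EuclideanSpace ℝ (Fin d) → ℝ := fun n => (picardMap f w)^[n] w
  have hgs : ∀ n, g (n + 1) = picardMap f w (g n) := fun n => Function.iterate_succ_apply' _ _ _
  have hg : ∀ n, IsBoundedMeasurable T (g n) := by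
    intro n
    induction n with
    | zero => exact hw
    | succ n ih => rw [hgs]; exact hw.picardMap hT hL ih hf
  obtain ⟨D, hD, hb⟩ := (hg 0).exists_abs_sub_le hL (hg 1)
  have hdist : ∀ n : ℕ, ∀ t ∈ Icc 0 T, ∀ x,
      |g n t x - g (n + 1) t x| ≤ D / 2 ^ n * Real.exp (c * t) := by
    intro n
    induction n with
    | zero => simpa using hb
    | succ n ih =>
      intro t ht x
      rw [hgs (n + 1)]
      nth_rw 1 [hgs n]
      rw [pow_succ, ← div_div]
      exact abs_picardMap_sub_le hT hL (hg n) (hg (n + 1)) hf (by positivity) ih ht x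
  have hdist' : ∀ t ∈ Icc 0 T, ∀ x, ∀ n : ℕ,
      dist (g n t x) (g (n + 1) t x) ≤ 2 * D * Real.exp (c * t) / 2 / 2 ^ n := by
    intro t ht x n
    refine (hdist n t ht x).trans_eq ?_
    ring
  let u : ℝ → EuclideanSpace ℝ (Fin d) → ℝ := fun t x => limUnder atTop fun n => g n t x
  have hlim : ∀ t ∈ Icc 0 T, ∀ x, Tendsto (fun n => g n t x) atTop (𝓝 (u t x)) :=
    fun t ht x => (cauchySeq_of_le_geometric_two (hdist' t ht x)).tendsto_limUnder
  have herr : ∀ n : ℕ, ∀ t ∈ Icc 0 T, ∀ x,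
      |g n t x - u t x| ≤ 2 * D / 2 ^ n * Real.exp (c * t) := by
    intro n t ht x
    refine (dist_le_of_le_geometric_two_of_tendsto (hdist' t ht x) (hlim t ht x) n).trans_eq ?_
    ring
  have hu : IsBoundedMeasurable T u := by
    refine ⟨measurable_of_tendsto_metrizable (fun n => (hg n).1)
      (tendsto_pi_nhds.2 fun q => hlim q.1 q.1.2 q.2), ?_⟩
    obtain ⟨M, hM⟩ := (hg 0).2
    refine ⟨M + 2 * D * Real.exp (c * T), fun t ht x => ?_⟩
    have h1 := herr 0 t ht x
    have h2 : 2 * D * Real.exp (c * t) ≤ 2 * D * Real.exp (c * T) := by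
      have := (picardRate_pos (d := d) hL).le
      gcongr
      exact ht.2
    have h3 := abs_sub_abs_le_abs_sub (u t x) (g 0 t x)
    rw [abs_sub_comm] at h3
    have h4 := hM t ht x
    simp only [pow_zero, div_one] at h1
    linarith
  refine ⟨u, isMildSolution_iff.2 ⟨hu, fun t ht x => ?_⟩⟩
  refine tendsto_nhds_unique ((tendsto_add_atTop_iff_nat 1).2 (hlim t ht x)) ?_
  simp_rw [hgs]
  refine tendsto_iff_dist_tendsto_zero.2 (squeeze_zero (fun _ => dist_nonneg) (fun n => ?_)
    (tendsto_div_two_pow_mul D (Real.exp (c * t))))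
  refine (abs_picardMap_sub_le hT hL (hg n) hu hf (by positivity) (herr n) ht x).trans_eq ?_
  ring

end Picard

/-- **Existence and uniqueness for the quasi-linear heat integral equation.**
For `d ≥ 1`, `T > 0`, `L ≥ 0`, `f` Lipschitz with constant `L`, and `w` bounded and
measurable on `[0,T] × ℝ^d`, there is a bounded measurable `u` satisfying
`u(t,x) = w(t,x) + ∫₀^t ∫_{ℝ^d} f(u(s,y)) (t-s)^{-d/2} exp(-|x-y|²/(2(t-s))) dy ds`
on `[0,T] × ℝ^d`, and `u` is the unique such solution. -/
theorem quasilinear_heat_existence_uniqueness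
    (d : ℕ) (hd : 1 ≤ d) (T L : ℝ) (hT : 0 < T) (hL : 0 ≤ L)
    (f : ℝ → ℝ) (hf : ∀ x y : ℝ, |f x - f y| ≤ L * |x - y|)
    (w : ℝ → EuclideanSpace ℝ (Fin d) → ℝ)
    (hw_meas : Measurable (fun q : (Icc (0 : ℝ) T) × EuclideanSpace ℝ (Fin d) => w q.1 q.2))
    (B : ℝ) (hw_bdd : ∀ t ∈ Icc (0 : ℝ) T, ∀ x, |w t x| ≤ B) :
    ∃ u : ℝ → EuclideanSpace ℝ (Fin d) → ℝ,
      IsMildSolution d T f w u ∧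
      ∀ v : ℝ → EuclideanSpace ℝ (Fin d) → ℝ, IsMildSolution d T f w v →
        ∀ t ∈ Icc (0 : ℝ) T, ∀ x, v t x = u t x := by
  obtain ⟨u, hu⟩ := exists_isMildSolution hT.le hL hf ⟨hw_meas, B, hw_bdd⟩
  exact ⟨u, hu, fun v hv t ht x => hv.eq hT.le hL hf hu ht x⟩
end
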